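/- If the term (t u₁ … uₙ) is strongly normalizing for the combined reduction by β, δ, γ and assoc, then so is ((λx.(t x)) u₁ … uₙ), where x is a variable not free in t. -/

import Mathlib

/-- Untyped λ-terms in de Bruijn representation. -/
inductive Lam : Type
  | var : ℕ → Lam
  | lam : Lam → Lam
  | app : Lam → Lam → Lam

namespace Lam

/-- Renaming of de Bruijn indices (extended under binders). -/
def rename (f : ℕ → ℕ) : Lam → Lam
  | var n => var (f n)
  | lam b => lam (rename (fun n => match n with | 0 => 0 | m+1 => f m + 1) b)
  | app a b => app (rename f a) (rename f b)

/-- Shift all free indices up by one. -/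
def shift : Lam → Lam := rename Nat.succ

/-- Swap the two innermost free indices. -/
def swap01 : Lam → Lam := rename (fun n => match n with | 0 => 1 | 1 => 0 | m => m)

/-- Capture-avoiding substitution of `u` for the free variable (index) `k`. -/
def subst : Lam → ℕ → Lam → Lam
  | var n, k, u => if n = k then u else if k < n then var (n-1) else var n
  | lam b, k, u => lam (subst b (k+1) (shift u))
  | app a b, k, u => app (subst a k u) (subst b k u)

/-- The names of the four reduction rules. -/
inductive Rule | beta | delta | gamma | assoc

/-- One-step reduction by a given rule, closed under all term contexts.
β : (λx.M) N ▷ M[x:=N]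
δ : (λy.λx.M) N ▷ λx.((λy.M) N)   (x ∉ FV N)
γ : ((λx.M) N) P ▷ (λx.(M P)) N   (x ∉ FV P)
assoc : M ((λx.N) P) ▷ (λx.(M N)) P   (x ∉ FV M) -/
inductive StepR : Rule → Lam → Lam → Prop
  | beta (M N) : StepR .beta (app (lam M) N) (subst M 0 N)
  | delta (M N) : StepR .delta (app (lam (lam M)) N) (lam (app (lam (swap01 M)) (shift N)))
  | gamma (M N P) : StepR .gamma (app (app (lam M) N) P) (app (lam (app M (shift P))) N)
  | assoc (M N P) : StepR .assoc (app M (app (lam N) P)) (app (lam (app (shift M) N)) P)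
  | appL {r M M'} (N) : StepR r M M' → StepR r (app M N) (app M' N)
  | appR {r N N'} (M) : StepR r N N' → StepR r (app M N) (app M N')
  | under {r M M'} : StepR r M M' → StepR r (lam M) (lam M')

/-- One-step reduction by any of β, δ, γ, assoc. -/
def Step (t t' : Lam) : Prop := ∃ r, StepR r t t'

/-- One-step β-reduction alone. -/
def StepBeta : Lam → Lam → Prop := StepR Rule.beta

/-- `t` is strongly normalizing for the reduction relation `R`:
every `R`-reduction sequence from `t` is finite. -/
def SN (R : Lam → Lam → Prop) (t : Lam) : Prop := Acc (fun a b => R b a) t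

/-- Left-nested application `(H M₁ … Mₙ)`. -/
def apps : Lam → List Lam → Lam
  | H, [] => H
  | H, M :: Ms => apps (app H M) Ms

/-- Types of system 𝒟 : atoms, arrow and intersection. -/
inductive Ty : Type
  | atom : ℕ → Ty
  | arrow : Ty → Ty → Ty
  | inter : Ty → Ty → Ty

/-- Typing judgment of system 𝒟 (contexts are lists of types, de Bruijn style). -/
inductive Typed : List Ty → Lam → Ty → Prop
  | var {Γ n A} : Γ[n]? = some A → Typed Γ (var n) A
  | app {Γ M N A B} : Typed Γ M (.arrow A B) → Typed Γ N A → Typed Γ (app M N) B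
  | lam {Γ M A B} : Typed (A :: Γ) M B → Typed Γ (lam M) (.arrow A B)
  | interI {Γ M A B} : Typed Γ M A → Typed Γ M B → Typed Γ M (.inter A B)
  | interE1 {Γ M A B} : Typed Γ M (.inter A B) → Typed Γ M A
  | interE2 {Γ M A B} : Typed Γ M (.inter A B) → Typed Γ M B

/-- A term is typable in system 𝒟 if it has a type in some context. -/
def Typable (t : Lam) : Prop := ∃ Γ A, Typed Γ t A

end Lam

namespace Lam

open Relation

/-! ### Parallel substitution -/

/-- Extension of a parallel substitution under a binder. -/
def up (σ : ℕ → Lam) : ℕ → Lam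
  | 0 => var 0
  | n + 1 => shift (σ n)

/-- Parallel substitution. -/
def psub (σ : ℕ → Lam) : Lam → Lam
  | var n => σ n
  | lam b => lam (psub (up σ) b)
  | app a b => app (psub σ a) (psub σ b)

/-- The parallel substitution performed by `subst · k u`. -/
def single (k : ℕ) (u : Lam) (n : ℕ) : Lam :=
  if n = k then u else if k < n then var (n - 1) else var n

theorem rename_eq_psub (f : ℕ → ℕ) (t : Lam) : rename f t = psub (fun n => var (f n)) t := by
  induction t generalizing f with
  | var n => rfl
  | lam b ih =>
    simp only [rename, psub, ih]
    congr 2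
    funext n
    cases n <;> rfl
  | app a b iha ihb => simp only [rename, psub, iha, ihb]

theorem psub_rename (σ : ℕ → Lam) (f : ℕ → ℕ) (t : Lam) :
    psub σ (rename f t) = psub (fun n => σ (f n)) t := by
  induction t generalizing σ f with
  | var n => rfl
  | lam b ih =>
    simp only [rename, psub, ih]
    congr 2
    funext n
    cases n <;> rfl
  | app a b iha ihb => simp only [rename, psub, iha, ihb]

theorem rename_rename (f g : ℕ → ℕ) (t : Lam) :
    rename g (rename f t) = rename (fun n => g (f n)) t := by
  rw [rename_eq_psub g, psub_rename, ← rename_eq_psub]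

theorem rename_psub (f : ℕ → ℕ) (σ : ℕ → Lam) (t : Lam) :
    rename f (psub σ t) = psub (fun n => rename f (σ n)) t := by
  induction t generalizing σ f with
  | var n => rfl
  | lam b ih =>
    simp only [rename, psub, ih]
    congr 2
    funext n
    cases n with
    | zero => rfl
    | succ n => simp only [up, shift, rename_rename, Nat.succ_eq_add_one]
  | app a b iha ihb => simp only [rename, psub, iha, ihb]

theorem psub_up_shift (σ : ℕ → Lam) (t : Lam) : psub (up σ) (shift t) = shift (psub σ t) := by
  rw [shift, psub_rename, rename_psub]
  rfl

theorem psub_psub (τ σ : ℕ → Lam) (t : Lam) :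
    psub τ (psub σ t) = psub (fun n => psub τ (σ n)) t := by
  induction t generalizing τ σ with
  | var n => rfl
  | lam b ih =>
    simp only [psub, ih]
    congr 2
    funext n
    cases n with
    | zero => rfl
    | succ n => simp only [up, psub_up_shift]
  | app a b iha ihb => simp only [psub, iha, ihb]

theorem up_var : up var = var := by
  funext n
  cases n <;> rfl

theorem psub_var (t : Lam) : psub var t = t := by
  induction t with
  | var n => rfl
  | lam b ih => rw [psub, up_var, ih]
  | app a b iha ihb => rw [psub, iha, ihb]

theorem up_single (k : ℕ) (u : Lam) : up (single k u) = single (k + 1) (shift u) := by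
  funext n
  cases n with
  | zero => simp [up, single]
  | succ n =>
    simp only [up, single, Nat.add_right_cancel_iff, Nat.add_lt_add_iff_right]
    split_ifs with h1 h2
    · rfl
    · obtain ⟨m, rfl⟩ : ∃ m, n = m + 1 := ⟨n - 1, by omega⟩
      rfl
    · rfl

theorem subst_eq_psub (t : Lam) (k : ℕ) (u : Lam) : subst t k u = psub (single k u) t := by
  induction t generalizing k u with
  | var n => rfl
  | lam b ih => rw [subst, psub, up_single, ih]
  | app a b iha ihb => rw [subst, psub, iha, ihb]

theorem psub_single_shift (t u : Lam) : psub (single 0 u) (shift t) = t := by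
  rw [shift, psub_rename]
  exact psub_var t

theorem subst_shift (t u : Lam) : subst (shift t) 0 u = t := by
  rw [subst_eq_psub, psub_single_shift]

theorem psub_subst (σ : ℕ → Lam) (t u : Lam) :
    psub σ (subst t 0 u) = subst (psub (up σ) t) 0 (psub σ u) := by
  rw [subst_eq_psub, subst_eq_psub, psub_psub, psub_psub]
  congr 1
  funext n
  cases n with
  | zero => rfl
  | succ n =>
    rw [up, psub_single_shift]
    rfl

theorem subst_swap01 (t u : Lam) : subst (swap01 t) 0 (shift u) = subst t 1 (shift u) := by
  rw [subst_eq_psub, subst_eq_psub, swap01, psub_rename]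
  congr 1
  funext n
  rcases n with _ | _ | n <;> rfl

theorem psub_swap01 (σ : ℕ → Lam) (t : Lam) :
    psub (up (up σ)) (swap01 t) = swap01 (psub (up (up σ)) t) := by
  rw [swap01, psub_rename, rename_psub]
  congr 1
  funext n
  rcases n with _ | _ | n
  · rfl
  · rfl
  · simp only [up, shift, rename_rename]

/-! ### Reduction and substitution -/

theorem StepR.psub {r : Rule} {t s : Lam} (h : StepR r t s) (σ : ℕ → Lam) :
    StepR r (psub σ t) (psub σ s) := by
  induction h generalizing σ with
  | beta M N =>
    rw [psub_subst]
    exact .beta _ _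
  | delta M N =>
    simp only [Lam.psub, psub_swap01, psub_up_shift]
    exact .delta _ _
  | gamma M N P =>
    simp only [Lam.psub, psub_up_shift]
    exact .gamma _ _ _
  | assoc M N P =>
    simp only [Lam.psub, psub_up_shift]
    exact .assoc _ _ _
  | appL N _ ih => exact .appL _ (ih σ)
  | appR M _ ih => exact .appR _ (ih σ)
  | under _ ih => exact .under (ih _)

theorem reflTransGen_app {r : Rule} {a a' b b' : Lam} (ha : ReflTransGen (StepR r) a a')
    (hb : ReflTransGen (StepR r) b b') : ReflTransGen (StepR r) (app a b) (app a' b') :=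
  (ha.lift (fun x => app x b) fun _ _ h => .appL b h).trans
    (hb.lift (app a') fun _ _ h => .appR a' h)

theorem reflTransGen_psub {r : Rule} (t : Lam) {σ τ : ℕ → Lam}
    (h : ∀ n, ReflTransGen (StepR r) (σ n) (τ n)) :
    ReflTransGen (StepR r) (psub σ t) (psub τ t) := by
  induction t generalizing σ τ with
  | var n => exact h n
  | lam b ih =>
    refine (ih fun n => ?_).lift lam fun _ _ h => .under h
    cases n with
    | zero => exact .refl
    | succ n =>
      refine (h n).lift shift fun a b hab => ?_
      rw [Function.onFun, shift, rename_eq_psub, rename_eq_psub]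
      exact hab.psub _
  | app a b iha ihb => exact reflTransGen_app (iha h) (ihb h)

theorem reflTransGen_subst {r : Rule} (t : Lam) {u v : Lam} (h : StepR r u v) :
    ReflTransGen (StepR r) (subst t 0 u) (subst t 0 v) := by
  rw [subst_eq_psub, subst_eq_psub]
  refine reflTransGen_psub t fun n => ?_
  cases n with
  | zero => exact .single h
  | succ n => exact .refl

/-! ### Weak head reduction and neutral terms -/

/-- `WH t N t'`: weak head β-reduction of `t` to `t'` contracting a redex with argument `N`. -/
inductive WH : Lam → Lam → Lam → Prop
  | head (M N) : WH (app (lam M) N) N (subst M 0 N)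
  | app {a N c} (b) : WH a N c → WH (app a b) N (app c b)

/-- Variables applied to arguments. -/
inductive Neu : Lam → Prop
  | var (n) : Neu (var n)
  | app {a} (b) : Neu a → Neu (app a b)

theorem WH.psub {t N t' : Lam} (h : WH t N t') (σ : ℕ → Lam) :
    WH (psub σ t) (psub σ N) (psub σ t') := by
  induction h with
  | head M N =>
    rw [psub_subst]
    exact .head _ _
  | app b _ ih => exact .app _ ih

theorem WH.step {t N t' : Lam} (h : WH t N t') : StepR .beta t t' := by
  induction h with
  | head M N => exact .beta M N
  | app b _ ih => exact .appL b ih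

theorem WH.not_neu {t N t' : Lam} (h : WH t N t') : ¬ Neu t := by
  induction h with
  | head M N => rintro (_ | ⟨_, ⟨⟩⟩)
  | app b _ ih =>
    rintro (_ | ⟨_, h⟩)
    exact ih h

theorem WH.unique {t N t' P s : Lam} (h : WH t N t') (h' : WH t P s) : N = P ∧ t' = s := by
  induction h generalizing s with
  | head M N =>
    cases h' with
    | head => exact ⟨rfl, rfl⟩
    | app _ h => cases h
  | app b h ih =>
    cases h' with
    | head => cases h
    | app _ h' =>
      obtain ⟨rfl, rfl⟩ := ih h'
      exact ⟨rfl, rfl⟩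

theorem lam_or_neu_or_wh (t : Lam) : (∃ b, t = lam b) ∨ Neu t ∨ ∃ N t', WH t N t' := by
  induction t with
  | var n => exact .inr (.inl (.var n))
  | lam b _ => exact .inl ⟨b, rfl⟩
  | app a b iha _ =>
    obtain ⟨M, rfl⟩ | h | ⟨N, a', h⟩ := iha
    · exact .inr (.inr ⟨b, _, .head M b⟩)
    · exact .inr (.inl (.app b h))
    · exact .inr (.inr ⟨N, _, .app b h⟩)

theorem Neu.psub_var {t : Lam} (h : Neu t) (f : ℕ → ℕ) : Neu (psub (fun n => Lam.var (f n)) t) := by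
  induction h with
  | var n => exact .var _
  | app b _ ih => exact .app _ ih

theorem wh_assoc (M N P : Lam) :
    WH (app (lam (app (shift M) N)) P) P (app M (subst N 0 P)) := by
  have h := WH.head (app (shift M) N) P
  rwa [subst, subst_shift] at h

theorem wh_gamma (M N P : Lam) :
    WH (app (lam (app M (shift P))) N) N (app (subst M 0 N) P) := by
  have h := WH.head (app M (shift P)) N
  rwa [subst, subst_shift] at h

theorem Neu.step {r : Rule} {a a' : Lam} (h : Neu a) (hs : StepR r a a') :
    Neu a' ∨ ∃ P a'', WH a' P a'' ∧ Neu a'' := by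
  induction h generalizing a' with
  | var n => cases hs
  | @app a b h ih =>
    cases hs with
    | beta | delta => cases h
    | gamma => exact absurd h (WH.head _ _).not_neu
    | assoc _ N P => exact .inr ⟨_, _, wh_assoc a N P, .app _ h⟩
    | appL _ hs =>
      obtain h | ⟨P, a'', hw, h⟩ := ih hs
      · exact .inl (.app b h)
      · exact .inr ⟨P, _, .app b hw, .app b h⟩
    | appR _ hs => exact .inl (.app _ h)

/-- How a step `t ▷ s` by a given rule interacts with a weak head reduction `WH t N t'`. -/
inductive HeadStep (N t' : Lam) : Rule → Lam → Prop
  | contract : HeadStep N t' .beta t'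
  | commute {r s s'} : WH s N s' → StepR r t' s' → HeadStep N t' r s
  | arg {r s N' s'} : StepR r N N' → WH s N' s' → ReflTransGen (StepR r) t' s' →
      HeadStep N t' r s
  | gamma {s} : WH s N t' → HeadStep N t' .gamma s
  | assocSpine {P s s₁ s₂ w} : WH s P s₁ → WH s₁ N s₂ → StepR .assoc t' w → WH w P s₂ →
      HeadStep N t' .assoc s
  | assocArg {P Q s s₁ s₂} : WH N P Q → WH s P s₁ → WH s₁ Q s₂ →
      ReflTransGen (StepR .beta) t' s₂ → HeadStep N t' .assoc s
  | deltaLam {s t₁} : t' = lam t₁ → WH s (shift N) t₁ → HeadStep N t' .delta (lam s)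
  | deltaSpine {u s s₁ s₂} : WH s u s₁ → WH s₁ N s₂ → WH t' u s₂ → HeadStep N t' .delta s

theorem HeadStep.app {N t' s : Lam} {r : Rule} (h : HeadStep N t' r s) (b : Lam) :
    HeadStep N (app t' b) r (app s b) := by
  cases h with
  | contract => exact .contract
  | commute h₁ h₂ => exact .commute (.app b h₁) (.appL b h₂)
  | arg h₁ h₂ h₃ => exact .arg h₁ (.app b h₂) (reflTransGen_app h₃ .refl)
  | gamma h => exact .gamma (.app b h)
  | assocSpine h₁ h₂ h₃ h₄ => exact .assocSpine (.app b h₁) (.app b h₂) (.appL b h₃) (.app b h₄)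
  | assocArg h₁ h₂ h₃ h₄ =>
    exact .assocArg h₁ (.app b h₂) (.app b h₃) (reflTransGen_app h₄ .refl)
  | @deltaLam s t₁ h₁ h₂ =>
    subst h₁
    have h := h₂.psub (single 0 b)
    rw [psub_single_shift, ← subst_eq_psub, ← subst_eq_psub] at h
    exact .deltaSpine (.head s b) h (.head t₁ b)
  | deltaSpine h₁ h₂ h₃ => exact .deltaSpine (.app b h₁) (.app b h₂) (.app b h₃)

theorem WH.headStep {t N t' s : Lam} {r : Rule} (h : WH t N t') (hs : StepR r t s) :
    HeadStep N t' r s := by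
  induction h generalizing s with
  | head M N =>
    cases hs with
    | beta => exact .contract
    | delta M N =>
      refine .deltaLam rfl ?_
      rw [← subst_swap01]
      exact .head _ _
    | assoc _ N P =>
      exact .assocArg (.head N P) (wh_assoc _ _ _) (.head _ _) (reflTransGen_subst M (.beta N P))
    | appL _ hs =>
      cases hs with
      | under hs =>
        refine .commute (.head _ _) ?_
        rw [subst_eq_psub, subst_eq_psub]
        exact hs.psub _
    | appR _ hs => exact .arg hs (.head _ _) (reflTransGen_subst M hs)
  | @app a N a' b h ih =>
    cases hs with
    | beta | delta => cases h
    | gamma M P _ =>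
      cases h with
      | head => exact .gamma (wh_gamma _ _ _)
      | app _ h => cases h
    | assoc _ Q P =>
      exact .assocSpine (wh_assoc _ _ _) (.app _ h) (.assoc _ _ _) (wh_assoc _ _ _)
    | appL _ hs => exact (ih hs).app b
    | appR _ hs => exact .commute (.app _ h) (.appR _ hs)

/-! ### A bound on β-reductions that permutations do not increase -/

/-- `Bounded n t`: the perpetual head strategy, counting also the reductions of the arguments of
contracted redexes, terminates on `t` within cost `n`. -/
inductive Bounded : ℕ → Lam → Prop
  | var (n x) : Bounded n (var x)
  | lam {n b} : Bounded n b → Bounded n (lam b)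
  | neu {n m k a b} : Neu a → Bounded n a → Bounded m b → n + m ≤ k → Bounded k (app a b)
  | wh {n m k t N t'} : WH t N t' → Bounded n t' → Bounded m N → n + m + 1 ≤ k → Bounded k t

theorem Bounded.mono {n m : ℕ} {t : Lam} (h : Bounded n t) (hnm : n ≤ m) : Bounded m t := by
  induction h generalizing m with
  | var n x => exact .var m x
  | lam _ ih => exact .lam (ih hnm)
  | neu h ha hb hk => exact .neu h ha hb (hk.trans hnm)
  | wh h ht hN hk => exact .wh h ht hN (hk.trans hnm)

theorem Bounded.wh_inv {k : ℕ} {t N t' : Lam} (h : Bounded k t) (hw : WH t N t') :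
    ∃ n m, Bounded n t' ∧ Bounded m N ∧ n + m + 1 ≤ k := by
  cases h with
  | var | lam => cases hw
  | neu h => exact absurd (.app _ h) hw.not_neu
  | wh h ht hN hk =>
    obtain ⟨rfl, rfl⟩ := h.unique hw
    exact ⟨_, _, ht, hN, hk⟩

theorem Bounded.lam_inv {k : ℕ} {b : Lam} (h : Bounded k (Lam.lam b)) : Bounded k b := by
  cases h with
  | lam h => exact h
  | wh h => cases h

theorem Bounded.psub_var {n : ℕ} {t : Lam} (h : Bounded n t) (f : ℕ → ℕ) :
    Bounded n (psub (fun x => Lam.var (f x)) t) := by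
  induction h generalizing f with
  | var n x => exact .var _ _
  | @lam n b _ ih =>
    have h := ih fun x => x.casesOn 0 fun m => f m + 1
    refine .lam ?_
    convert h using 2
    funext x
    cases x <;> rfl
  | neu h _ _ hk iha ihb => exact .neu (h.psub_var f) (iha f) (ihb f) hk
  | wh h _ _ hk iht ihN => exact .wh (h.psub _) (iht f) (ihN f) hk

theorem Bounded.shift {n : ℕ} {t : Lam} (h : Bounded n t) : Bounded n (shift t) := by
  rw [Lam.shift, rename_eq_psub]
  exact h.psub_var _

/-- The decrease of the bound guaranteed by a step of a given rule. -/
def Rule.cost : Rule → ℕ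
  | .beta => 1
  | _ => 0

/-- `t` is bounded by `n` minus the cost of `r`. -/
def BoundedAfter (r : Rule) (n : ℕ) (t : Lam) : Prop := ∃ m, m + r.cost ≤ n ∧ Bounded m t

theorem bounded_reflTransGen {r : Rule} {n : ℕ}
    (ih : ∀ t s, Bounded n t → StepR r t s → BoundedAfter r n s) {t s : Lam}
    (h : Bounded n t) (hs : ReflTransGen (StepR r) t s) : Bounded n s := by
  induction hs with
  | refl => exact h
  | tail _ hs h =>
    obtain ⟨m, hm, h⟩ := ih _ _ h hs
    exact h.mono (by omega)

theorem HeadStep.boundedAfter {r : Rule} {n m k : ℕ} {N t' s : Lam} (hs : HeadStep N t' r s)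
    (ih : ∀ j < k, ∀ r t s, Bounded j t → StepR r t s → BoundedAfter r j s)
    (ht : Bounded n t') (hN : Bounded m N) (hk : n + m + 1 ≤ k) : BoundedAfter r k s := by
  cases hs with
  | contract => exact ⟨n, by simp only [Rule.cost]; omega, ht⟩
  | commute h₁ h₂ =>
    obtain ⟨n', hn', h⟩ := ih n (by omega) _ _ _ ht h₂
    exact ⟨n' + m + 1, by omega, .wh h₁ h hN le_rfl⟩
  | arg h₁ h₂ h₃ =>
    obtain ⟨m', hm', h⟩ := ih m (by omega) _ _ _ hN h₁
    exact ⟨n + m' + 1, by omega,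
      .wh h₂ (bounded_reflTransGen (ih n (by omega) _) ht h₃) h le_rfl⟩
  | gamma h => exact ⟨k, le_rfl, .wh h ht hN hk⟩
  | assocSpine h₁ h₂ h₃ h₄ =>
    obtain ⟨n', hn', h⟩ := ih n (by omega) _ _ _ ht h₃
    obtain ⟨a, b, ha, hb, hab⟩ := h.wh_inv h₄
    exact ⟨k, le_rfl, .wh h₁ (.wh h₂ ha hN le_rfl) hb (by omega)⟩
  | assocArg h₁ h₂ h₃ h₄ =>
    obtain ⟨a, b, ha, hb, hab⟩ := hN.wh_inv h₁
    have h := bounded_reflTransGen (ih n (by omega) _) ht h₄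
    exact ⟨k, le_rfl, .wh h₂ (.wh h₃ h ha le_rfl) hb (by omega)⟩
  | deltaLam h₁ h₂ =>
    subst h₁
    exact ⟨k, le_rfl, .lam (.wh h₂ ht.lam_inv hN.shift hk)⟩
  | deltaSpine h₁ h₂ h₃ =>
    obtain ⟨a, b, ha, hb, hab⟩ := ht.wh_inv h₃
    exact ⟨k, le_rfl, .wh h₁ (.wh h₂ ha hN le_rfl) hb (by omega)⟩

theorem Bounded.boundedAfter {r : Rule} {n : ℕ} {t s : Lam} (h : Bounded n t)
    (hs : StepR r t s) : BoundedAfter r n s := by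
  induction n using Nat.strong_induction_on generalizing r t s with
  | _ k ih =>
  suffices H : ∀ t n, n ≤ k → Bounded n t → ∀ r s, StepR r t s → BoundedAfter r n s from
    H t k le_rfl h r s hs
  intro t
  induction t with
  | var x =>
    intro n _ _ r s hs
    cases hs
  | lam b ihb =>
    intro n hn h r s hs
    cases hs with
    | under hs =>
      obtain ⟨m, hm, h⟩ := ihb n hn h.lam_inv _ _ hs
      exact ⟨m, hm, .lam h⟩
  | app a b iha ihb =>
    intro n hn h r s hs
    cases h with
    | wh hw ht hN hk =>
      exact (hw.headStep hs).boundedAfter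
        (fun j hj r t s h hs => ih j (by omega) h hs) ht hN hk
    | neu hneu ha hb hk =>
      cases hs with
      | beta | delta => cases hneu
      | gamma => exact absurd hneu (WH.head _ _).not_neu
      | assoc _ N P =>
        obtain ⟨i, j, hi, hj, hij⟩ := hb.wh_inv (.head N P)
        exact ⟨n, le_rfl, .wh (wh_assoc a N P) (.neu hneu ha hi le_rfl) hj (by omega)⟩
      | appL _ hs =>
        obtain ⟨i, hi, h⟩ := iha _ (by omega) ha _ _ hs
        obtain hneu' | ⟨P, a'', hw, hneu'⟩ := hneu.step hs
        · exact ⟨_, by omega, .neu hneu' h hb le_rfl⟩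
        · obtain ⟨c, d, hc, hd, hcd⟩ := h.wh_inv hw
          exact ⟨_, by omega, .wh (.app b hw) (.neu hneu' hc hb le_rfl) hd le_rfl⟩
      | appR _ hs =>
        obtain ⟨i, hi, h⟩ := ihb _ (by omega) hb _ _ hs
        exact ⟨_, by omega, .neu hneu ha h le_rfl⟩

/-! ### Termination of the permutation rules -/

/-- A weight strictly decreased by the rules δ, γ and assoc. -/
def weight : Lam → ℕ
  | var _ => 2
  | lam b => weight b + 1
  | app a b => weight a * weight b

theorem two_le_weight (t : Lam) : 2 ≤ weight t := by
  induction t with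
  | var n => exact le_rfl
  | lam b ih => exact ih.trans (Nat.le_succ _)
  | app a b iha ihb =>
    simp only [weight]
    nlinarith

theorem weight_rename (f : ℕ → ℕ) (t : Lam) : weight (rename f t) = weight t := by
  induction t generalizing f with
  | var n => rfl
  | lam b ih => simp only [rename, weight, ih]
  | app a b iha ihb => simp only [rename, weight, iha, ihb]

theorem weight_lt {r : Rule} {t s : Lam} (h : StepR r t s) (hr : r ≠ .beta) :
    weight s < weight t := by
  induction h with
  | beta => exact absurd rfl hr
  | delta M N =>
    have := two_le_weight N
    simp only [weight, swap01, shift, weight_rename]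
    nlinarith
  | gamma M N P =>
    have := two_le_weight N
    have := two_le_weight P
    simp only [weight, shift, weight_rename]
    nlinarith
  | assoc M N P =>
    have := two_le_weight M
    have := two_le_weight P
    simp only [weight, shift, weight_rename]
    nlinarith
  | appL N _ ih =>
    have := two_le_weight N
    exact Nat.mul_lt_mul_of_pos_right (ih hr) (by omega)
  | appR M _ ih =>
    have := two_le_weight M
    exact Nat.mul_lt_mul_of_pos_left (ih hr) (by omega)
  | under _ ih => exact Nat.succ_lt_succ (ih hr)

/-! ### Bounded terms are the strongly normalizing ones -/

theorem Bounded.sn {n : ℕ} {t : Lam} (h : Bounded n t) : SN Step t := by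
  induction n using Nat.strong_induction_on generalizing t with
  | _ n ihn =>
  induction hw : weight t using Nat.strong_induction_on generalizing t with
  | _ w ihw =>
  refine Acc.intro _ ?_
  rintro s ⟨r, hs⟩
  obtain ⟨m, hm, hb⟩ := h.boundedAfter hs
  by_cases hr : r = .beta
  · subst hr
    exact ihn m hm hb
  · exact ihw _ (hw ▸ weight_lt hs hr) (hb.mono (by omega)) rfl

/-- `Sub s t`: the term `s` occurs in `t`. -/
inductive Sub (s : Lam) : Lam → Prop
  | refl : Sub s s
  | lam {b} : Sub s b → Sub s (lam b)
  | appL {a} (b) : Sub s a → Sub s (app a b)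
  | appR (a) {b} : Sub s b → Sub s (app a b)

theorem Sub.trans {a b c : Lam} (hab : Sub a b) (hbc : Sub b c) : Sub a c := by
  induction hbc with
  | refl => exact hab
  | lam _ ih => exact .lam ih
  | appL b _ ih => exact .appL b ih
  | appR a _ ih => exact .appR a ih

theorem Sub.step {s t s' : Lam} {r : Rule} (h : Sub s t) (hs : StepR r s s') :
    ∃ t', StepR r t t' ∧ Sub s' t' := by
  induction h with
  | refl => exact ⟨s', hs, .refl⟩
  | lam _ ih =>
    obtain ⟨t', h, h'⟩ := ih
    exact ⟨_, .under h, .lam h'⟩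
  | appL b _ ih =>
    obtain ⟨t', h, h'⟩ := ih
    exact ⟨_, .appL b h, .appL b h'⟩
  | appR a _ ih =>
    obtain ⟨t', h, h'⟩ := ih
    exact ⟨_, .appR a h, .appR a h'⟩

theorem WH.sub {t N t' : Lam} (h : WH t N t') : Sub N t ∧ sizeOf N < sizeOf t := by
  induction h with
  | head M N => exact ⟨.appR _ .refl, by simp⟩
  | app b _ ih => exact ⟨.appL b ih.1, ih.2.trans (by simp; omega)⟩

theorem SN.exists_bounded {t : Lam} (h : SN Step t) : ∀ s, Sub s t → ∃ n, Bounded n s := by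
  induction h with
  | intro t _ iht =>
  intro s hst
  induction hk : sizeOf s using Nat.strong_induction_on generalizing s with
  | _ k ihk =>
  obtain ⟨b, rfl⟩ | hneu | ⟨N, s', hw⟩ := lam_or_neu_or_wh s
  · obtain ⟨n, hb⟩ := ihk (sizeOf b) (by simp [← hk]) b (.trans (.lam .refl) hst) rfl
    exact ⟨n, .lam hb⟩
  · cases hneu with
    | var x => exact ⟨0, .var 0 x⟩
    | @app a b hneu =>
      obtain ⟨n, ha⟩ := ihk (sizeOf a) (by simp [← hk]; omega) a (.trans (.appL b .refl) hst) rfl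
      obtain ⟨m, hb⟩ := ihk (sizeOf b) (by simp [← hk]) b (.trans (.appR a .refl) hst) rfl
      exact ⟨n + m, .neu hneu ha hb le_rfl⟩
  · obtain ⟨m, hN⟩ := ihk (sizeOf N) (hk ▸ hw.sub.2) N (hw.sub.1.trans hst) rfl
    obtain ⟨t', ht, hsub⟩ := hst.step hw.step
    obtain ⟨n, hs'⟩ := iht t' ⟨_, ht⟩ s' hsub
    exact ⟨n + m + 1, .wh hw hs' hN le_rfl⟩

/-! ### η-expansion of the head -/

theorem Bounded.exists_app_var {n : ℕ} {t : Lam} (h : Bounded n t) (x : ℕ) :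
    ∃ m, Bounded m (Lam.app t (Lam.var x)) := by
  induction h with
  | var n y => exact ⟨0, .neu (.var y) (.var 0 y) (.var 0 x) le_rfl⟩
  | @lam n b h _ =>
    refine ⟨n + 0 + 1, .wh (.head b _) ?_ (.var 0 x) le_rfl⟩
    have h := h.psub_var fun y => y.casesOn x id
    rw [subst_eq_psub]
    convert h using 2
    funext y
    cases y <;> rfl
  | neu hneu ha hb hk => exact ⟨_, .neu (.app _ hneu) (.neu hneu ha hb hk) (.var 0 x) le_rfl⟩
  | wh hw _ hN _ iht _ =>
    obtain ⟨m, h⟩ := iht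
    exact ⟨_, .wh (.app _ hw) h hN le_rfl⟩

theorem WH.apps {t N t' : Lam} (h : WH t N t') (us : List Lam) :
    WH (apps t us) N (apps t' us) := by
  induction us generalizing t t' with
  | nil => exact h
  | cons u us ih => exact ih (.app u h)

theorem Sub.apps {s t : Lam} (h : Sub s t) (us : List Lam) : Sub s (apps t us) := by
  induction us generalizing t with
  | nil => exact h
  | cons u us ih => exact ih (.appL u h)

end Lam

open Lam in
/-- If `(t u₁ … uₙ)` is strongly normalizing for the combined
reduction by β, δ, γ, assoc, then so is `((λx.(t x)) u₁ … uₙ)` where `x` is not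
free in `t` (de Bruijn: the head is `λ.((shift t) 0)`). -/
theorem sn_eta_expand_head (t : Lam) (us : List Lam)
    (h : SN Step (apps t us)) :
    SN Step (apps (Lam.lam (Lam.app (shift t) (Lam.var 0))) us) := by
  cases us with
  | nil =>
    obtain ⟨n, ht⟩ := h.exists_bounded _ .refl
    obtain ⟨m, hm⟩ := ht.shift.exists_app_var 0
    exact hm.lam.sn
  | cons u us =>
    obtain ⟨n, ht⟩ := h.exists_bounded _ .refl
    obtain ⟨m, hu⟩ := h.exists_bounded u (Sub.apps (.appR t .refl) us)
    have hw : WH (.app (.lam (.app (shift t) (.var 0))) u) u (.app t u) := wh_assoc t (.var 0) u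
    exact (Bounded.wh (hw.apps us) ht hu le_rfl).sn
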